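/- arXiv:1907.04668 — 2 statements merged into one kernel-verified Lean document; each statement's English description precedes it below -/
import Mathlib

section
/- For every irreducible complex character χ of G = S_{2n}, the sum Σ_{h ∈ H} χ(h) equals either 0 or |H| = 2ⁿ·n!. Equivalently, the multiplicity of the trivial representation of H in the restriction to H of any irreducible complex representation of G is at most 1 (so (S_{2n}, H) is a Gelfand pair). -/
/-- The symmetric group `S_{2n}`. -/
abbrev PermG (n : ℕ) := Equiv.Perm (Fin (2 * n))

/-- The centralizer `H` of the fixed-point-free involution `ξ` in `S_{2n}`;
it is isomorphic to the wreath product `S_n[S₂]` and has order `2ⁿ·n!`. -/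
def wreathH (n : ℕ) (ξ : PermG n) : Subgroup (PermG n) :=
  Subgroup.centralizer {ξ}

/-- Two `d`-tuples `(σ₁,…,σ_d), (σ'₁,…,σ'_d) ∈ G^d` are equivalent if there exist
`γ₁,…,γ_d ∈ H` and `γ ∈ G` with `σ'ᵢ = γᵢσᵢγ` for all `i`. -/
def tensorRel (n d : ℕ) (ξ : PermG n) (σ σ' : Fin d → PermG n) : Prop :=
  ∃ (γv : Fin d → wreathH n ξ) (γ : PermG n),
    ∀ i, σ' i = (γv i : PermG n) * σ i * γ

/-- `Z_d(2n)`: the number of equivalence classes of `d`-tuples, i.e. the number of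
rank-`d` `O(N)` tensor invariants built from `2n` tensors. -/
noncomputable def Znum (n d : ℕ) (ξ : PermG n) : ℕ :=
  Nat.card (Quot (tensorRel n d ξ))

namespace Representation

variable {k G V : Type*} [Field k] [Group G] [AddCommGroup V] [Module k V]

/-- A submodule containing the orbit of a nonzero vector of an irreducible representation is
everything. -/
theorem IsIrreducible.eq_top_of_orbit_mem (ρ : Representation k G V) [IsIrreducible ρ] {w : V}
    (hw : w ≠ 0) (N : Submodule k V) (hN : ∀ g, ρ g w ∈ N) : N = ⊤ := by
  let S : Subrepresentation ρ :=
    { toSubmodule := Submodule.span k (Set.range fun g => ρ g w)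
      apply_mem_toSubmodule := fun g v hv => by
        have hle : Submodule.span k (Set.range fun g => ρ g w) ≤
            (Submodule.span k (Set.range fun g => ρ g w)).comap (ρ g) := by
          rw [Submodule.span_le]
          rintro _ ⟨x, rfl⟩
          exact Submodule.subset_span ⟨g * x, by simp⟩
        exact hle hv }
  have hwS : w ∈ S.toSubmodule := Submodule.subset_span ⟨1, by simp⟩
  have hS : S = ⊤ := (eq_bot_or_eq_top S).resolve_left fun h => hw <| by
    rw [h] at hwS
    exact (Submodule.mem_bot k).1 hwS
  have hSN : S.toSubmodule ≤ N := by
    rw [Submodule.span_le]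
    rintro _ ⟨x, rfl⟩
    exact hN x
  rw [hS] at hSN
  exact top_le_iff.1 hSN

variable (ρ : Representation k G V) (H : Subgroup G) [Fintype H]
  [Invertible (Fintype.card H : k)]

/-- The projection of `V` onto its `H`-invariants. -/
noncomputable def subgroupAverage : Module.End k V :=
  averageMap (ρ.comp H.subtype)

theorem subgroupAverage_eq :
    ρ.subgroupAverage H = ⅟(Fintype.card H : k) • ∑ h : H, ρ (h : G) := by
  simp [subgroupAverage, GroupAlgebra.average]

variable {H} in
theorem mul_subgroupAverage {h : G} (hh : h ∈ H) :
    ρ h * ρ.subgroupAverage H = ρ.subgroupAverage H := by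
  ext v
  exact averageMap_invariant (ρ.comp H.subtype) v ⟨h, hh⟩

variable {H} in
theorem subgroupAverage_mul {h : G} (hh : h ∈ H) :
    ρ.subgroupAverage H * ρ h = ρ.subgroupAverage H := by
  simp only [subgroupAverage_eq, smul_mul_assoc, Finset.sum_mul, ← map_mul]
  congr 1
  exact Equiv.sum_comp (Equiv.mulRight (⟨h, hh⟩ : H)) fun x : H => ρ (x : G)

/-- The action of the element `e_H g e_H` of the Hecke algebra of `H`. -/
noncomputable def heckeOp (g : G) : Module.End k V :=
  ρ.subgroupAverage H * ρ g * ρ.subgroupAverage H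

theorem heckeOp_mul_heckeOp (g g' : G) :
    ρ.heckeOp H g * ρ.heckeOp H g' =
      ⅟(Fintype.card H : k) • ∑ h : H, ρ.heckeOp H (g * h * g') := by
  have hP : ρ.subgroupAverage H * ρ.subgroupAverage H = ρ.subgroupAverage H := by
    ext v
    exact averageMap_id _ _ (averageMap_invariant (ρ.comp H.subtype) v)
  calc ρ.heckeOp H g * ρ.heckeOp H g'
      = ρ.subgroupAverage H * ρ g * (ρ.subgroupAverage H * ρ.subgroupAverage H) * ρ g' *
          ρ.subgroupAverage H := by simp only [heckeOp, mul_assoc]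
    _ = ρ.subgroupAverage H * ρ g * (⅟(Fintype.card H : k) • ∑ h : H, ρ (h : G)) * ρ g' *
          ρ.subgroupAverage H := by rw [hP, ← subgroupAverage_eq]
    _ = _ := by
      simp only [heckeOp, map_mul, mul_smul_comm, smul_mul_assoc, Finset.mul_sum, Finset.sum_mul,
        mul_assoc]

variable {H}

theorem heckeOp_inv (hH : ∀ g : G, ∃ h ∈ H, ∃ h' ∈ H, g⁻¹ = h * g * h') (g : G) :
    ρ.heckeOp H g⁻¹ = ρ.heckeOp H g := by
  obtain ⟨h, hh, h', hh', e⟩ := hH g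
  calc ρ.heckeOp H g⁻¹
      = (ρ.subgroupAverage H * ρ h) * ρ g * (ρ h' * ρ.subgroupAverage H) := by
        simp only [heckeOp, e, map_mul, mul_assoc]
    _ = ρ.heckeOp H g := by rw [subgroupAverage_mul ρ hh, mul_subgroupAverage ρ hh', heckeOp]

/-- **Gelfand's trick** for the inversion anti-automorphism. -/
theorem heckeOp_commute (hH : ∀ g : G, ∃ h ∈ H, ∃ h' ∈ H, g⁻¹ = h * g * h') (g g' : G) :
    ρ.heckeOp H g * ρ.heckeOp H g' = ρ.heckeOp H g' * ρ.heckeOp H g := by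
  rw [← heckeOp_inv ρ hH g, ← heckeOp_inv ρ hH g', heckeOp_mul_heckeOp, heckeOp_inv ρ hH g,
    heckeOp_inv ρ hH g', heckeOp_mul_heckeOp, ← Equiv.sum_comp (Equiv.inv H)]
  congr 1
  refine Finset.sum_congr rfl fun h _ => ?_
  rw [← heckeOp_inv ρ hH]
  simp [mul_assoc]

/-- If every `g` lies in the same `H`-double coset as its inverse, then the
`H`-invariants of an irreducible representation are at most one-dimensional. -/
theorem finrank_invariants_subgroup_le_one [IsAlgClosed k] [FiniteDimensional k V]
    [IsIrreducible ρ] (hH : ∀ g : G, ∃ h ∈ H, ∃ h' ∈ H, g⁻¹ = h * g * h') :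
    Module.finrank k (invariants (ρ.comp H.subtype)) ≤ 1 := by
  set W := invariants (ρ.comp H.subtype)
  set P := ρ.subgroupAverage H
  have hPW (v : V) : P v ∈ W := averageMap_invariant (ρ.comp H.subtype) v
  have hPid {v : V} (hv : v ∈ W) : P v = v := averageMap_id (ρ.comp H.subtype) v hv
  have hop (g : G) {v : V} (hv : v ∈ W) : ρ.heckeOp H g v = P (ρ g v) := by
    change P (ρ g (P v)) = _
    rw [hPid hv]
  rcases subsingleton_or_nontrivial W with hsub | hnt
  · rw [Module.finrank_zero_of_subsingleton]
    exact zero_le_one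
  have hscalar (g : G) : ∃ μ : k, ∀ v ∈ W, ρ.heckeOp H g v = μ • v := by
    let T : Module.End k W := (ρ.heckeOp H g).restrict fun v _ => hPW (ρ g (P v))
    obtain ⟨μ, hμ⟩ := Module.End.exists_eigenvalue T
    obtain ⟨w, hw⟩ := hμ.exists_hasEigenvector
    have hTw : ρ.heckeOp H g w = μ • (w : V) := congrArg Subtype.val hw.apply_eq_smul
    have hw0 : (w : V) ≠ 0 := fun h => hw.2 (Subtype.ext h)
    have htop := IsIrreducible.eq_top_of_orbit_mem ρ hw0
      (LinearMap.ker ((ρ.heckeOp H g - μ • 1) * P)) fun x => by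
        have hcomm := LinearMap.congr_fun (heckeOp_commute ρ hH g x) (w : V)
        simp only [Module.End.mul_apply, hTw, map_smul, hop x w.2] at hcomm
        simp [hcomm]
    refine ⟨μ, fun v hv => ?_⟩
    have hker : v ∈ LinearMap.ker ((ρ.heckeOp H g - μ • 1) * P) := htop ▸ Submodule.mem_top
    simpa [hPid hv, sub_eq_zero] using hker
  obtain ⟨w, hw⟩ := exists_ne (0 : W)
  have htop := IsIrreducible.eq_top_of_orbit_mem ρ (fun h => hw (Subtype.ext h) : (w : V) ≠ 0)
    ((Submodule.span k {(w : V)}).comap P) fun x => by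
      obtain ⟨μ, hμ⟩ := hscalar x
      rw [Submodule.mem_comap, ← hop x w.2, hμ w w.2]
      exact Submodule.smul_mem _ _ (Submodule.mem_span_singleton_self _)
  refine finrank_le_one w fun v => ?_
  have hv : (v : V) ∈ (Submodule.span k {(w : V)}).comap P := htop ▸ Submodule.mem_top
  rw [Submodule.mem_comap, hPid v.2, Submodule.mem_span_singleton] at hv
  obtain ⟨c, hc⟩ := hv
  exact ⟨c, Subtype.ext hc⟩

end Representation

namespace FDRep

open CategoryTheory

universe u v

theorem isIrreducible_of_simple {k : Type u} {G : Type v} [Field k] [Group G] (V : FDRep k G)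
    [Simple V] : Representation.IsIrreducible V.ρ := by
  have key (S : Subrepresentation V.ρ) : S = ⊥ ∨ S = ⊤ := by
    let i : FDRep.of S.toRepresentation ⟶ V :=
      ⟨InducedCategory.homMk (ModuleCat.ofHom S.toSubmodule.subtype), fun g => by
        ext1; rfl⟩
    have hi : Function.Injective i.hom.hom.hom := S.toSubmodule.injective_subtype
    have : Mono i := by
      have : Mono ((forget (FDRep k G)).map i) := (mono_iff_injective _).2 hi
      exact (forget (FDRep k G)).mono_of_mono_map this
    by_cases h0 : i = 0
    · left
      apply Subrepresentation.toSubmodule_injective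
      refine (Submodule.eq_bot_iff _).2 fun v hv => ?_
      have : i.hom.hom.hom ⟨v, hv⟩ = 0 := by rw [h0]; rfl
      exact this
    · right
      have := isIso_of_mono_of_nonzero h0
      apply Subrepresentation.toSubmodule_injective
      refine Submodule.eq_top_iff'.2 fun v => ?_
      have hv := (isoToLinearEquiv (asIso i)).apply_symm_apply v
      rw [← hv]
      exact ((isoToLinearEquiv (asIso i)).symm v).2
  have hnt : (⊥ : Subrepresentation V.ρ) ≠ ⊤ := fun h => by
    apply Simple.not_isZero V
    rw [Limits.IsZero.iff_id_eq_zero]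
    ext v
    have : v ∈ (⊤ : Subrepresentation V.ρ).toSubmodule := Submodule.mem_top
    rw [← h] at this
    exact this
  exact { exists_pair_ne := ⟨_, _, hnt⟩, eq_bot_or_eq_top := key }

end FDRep

namespace Equiv.Perm

variable {α : Type*}

/-- The union of two perfect matchings is a bipartite graph. -/
theorem exists_two_coloring_of_involutions [Finite α] (ξ η : Perm α) (hξ : ξ * ξ = 1)
    (hη : η * η = 1) (hξf : ∀ x, ξ x ≠ x) (hηf : ∀ x, η x ≠ x) :
    ∃ c : α → Prop, (∀ x, c (ξ x) ↔ ¬ c x) ∧ ∀ x, c (η x) ↔ ¬ c x := by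
  have hξ' (x : α) : ξ (ξ x) = x := congr($hξ x)
  have hη' (x : α) : η (η x) = x := congr($hη x)
  have hξi : ξ⁻¹ = ξ := inv_eq_of_mul_eq_one_left hξ
  have hηi : η⁻¹ = η := inv_eq_of_mul_eq_one_left hη
  set τ := ξ * η with hτ
  have hconj (m : ℤ) : ξ * τ ^ m = τ ^ (-m) * ξ := by
    have h1 : ξ * τ * ξ⁻¹ = τ⁻¹ := by
      rw [hτ, mul_inv_rev, hξi, hηi, ← mul_assoc, hξ, one_mul]
    have h2 : ξ * τ ^ m * ξ⁻¹ = τ ^ (-m) := by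
      rw [← conj_zpow, h1, inv_zpow, zpow_neg]
    rw [← h2, inv_mul_cancel_right]
  have hconj' (m : ℤ) (x : α) : ξ ((τ ^ m) x) = (τ ^ (-m)) (ξ x) := congr($(hconj m) x)
  have hsame {x y : α} (h : τ.SameCycle x y) : τ.SameCycle (ξ x) (ξ y) := by
    obtain ⟨m, rfl⟩ := h
    exact ⟨-m, (hconj' m x).symm⟩
  have hne (x : α) : ¬ τ.SameCycle x (ξ x) := by
    rintro ⟨j, hj⟩
    obtain ⟨m, rfl | rfl⟩ := Int.even_or_odd' j
    · apply hξf ((τ ^ m) x)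
      rw [hconj', ← hj, ← mul_apply, ← zpow_add]
      congr 2
      ring
    · apply hηf ((τ ^ m) x)
      apply ξ.injective
      change τ ((τ ^ m) x) = _
      rw [hconj', ← hj, ← mul_apply, ← mul_apply, ← zpow_add, ← zpow_one_add]
      congr 2
      ring
  let e := Finite.equivFin (Quotient (SameCycle.setoid τ))
  let f : α → Fin _ := fun x => e (Quotient.mk _ x)
  have hf {x y : α} : f x = f y ↔ τ.SameCycle x y :=
    e.injective.eq_iff.trans Quotient.eq
  have hfη (x : α) : f (η x) = f (ξ x) := hf.2 ⟨1, by simp [hτ, hη']⟩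
  have hfξη (x : α) : f (ξ (η x)) = f x :=
    (hf.2 ⟨1, by simp [hτ]⟩ : f x = f (ξ (η x))).symm
  have hfne (x : α) : f x ≠ f (ξ x) := fun h => hne x (hf.1 h)
  refine ⟨fun x => f x < f (ξ x), fun x => ?_, fun x => ?_⟩
  · simp only [hξ', not_lt]
    exact ⟨le_of_lt, fun h => lt_of_le_of_ne h (hfne x).symm⟩
  · simp only [hfη, hfξη, not_lt]
    exact ⟨le_of_lt, fun h => lt_of_le_of_ne h (hfne x).symm⟩

/-- Two fixed-point-free involutions can be swapped by a simultaneous conjugation. -/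
theorem exists_swap_involutions [Finite α] (ξ η : Perm α) (hξ : ξ * ξ = 1)
    (hη : η * η = 1) (hξf : ∀ x, ξ x ≠ x) (hηf : ∀ x, η x ≠ x) :
    ∃ σ : Perm α, σ * ξ = η * σ ∧ σ * η = ξ * σ := by
  classical
  obtain ⟨c, hcξ, hcη⟩ := exists_two_coloring_of_involutions ξ η hξ hη hξf hηf
  have hξ' (x : α) : ξ (ξ x) = x := congr($hξ x)
  have hη' (x : α) : η (η x) = x := congr($hη x)
  let σ : Perm α :=
    { toFun := fun x => if c x then ξ x else η x
      invFun := fun x => if c x then η x else ξ x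
      left_inv := fun x => by by_cases h : c x <;> simp [h, hcξ, hcη, hξ', hη']
      right_inv := fun x => by by_cases h : c x <;> simp [h, hcξ, hcη, hξ', hη'] }
  have hσ (x : α) : σ x = if c x then ξ x else η x := rfl
  refine ⟨σ, ?_, ?_⟩ <;> ext x <;> by_cases h : c x <;> simp [hσ, h, hcξ, hcη, hξ', hη']

theorem inv_mem_doubleCoset_centralizer [Finite α] (ξ : Perm α) (hξ : ξ * ξ = 1)
    (hξf : ∀ x, ξ x ≠ x) (g : Perm α) :
    ∃ h ∈ Subgroup.centralizer {ξ}, ∃ h' ∈ Subgroup.centralizer {ξ}, g⁻¹ = h * g * h' := by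
  obtain ⟨σ, h₁, h₂⟩ := exists_swap_involutions ξ (g * ξ * g⁻¹) hξ
    (by rw [conj_mul, hξ]; simp) hξf fun x h => hξf (g⁻¹ x) (eq_inv_iff_eq.2 h)
  have hl : g⁻¹ * σ ∈ Subgroup.centralizer {ξ} := by
    rw [Subgroup.mem_centralizer_singleton_iff]
    simp only [mul_assoc] at h₁ ⊢
    simp [h₁]
  have hr : σ * g ∈ Subgroup.centralizer {ξ} := by
    rw [Subgroup.mem_centralizer_singleton_iff]
    calc σ * g * ξ = σ * (g * ξ * g⁻¹) * g := by group
      _ = ξ * (σ * g) := by rw [h₂, mul_assoc]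
  exact ⟨g⁻¹ * σ, hl, (σ * g)⁻¹, inv_mem hr, by group⟩

theorem nat_card_centralizer_of_involution [Fintype α] [DecidableEq α] {n : ℕ}
    (hα : Fintype.card α = 2 * n) (ξ : Perm α) (hξ : ξ * ξ = 1) (hξf : ∀ x, ξ x ≠ x) :
    Nat.card (Subgroup.centralizer {ξ}) = 2 ^ n * n.factorial := by
  have hct := cycleType_of_pow_prime_eq_one (p := 2) (σ := ξ) (by rw [sq, hξ])
  have hsupp : ξ.support = Finset.univ := by ext x; simp [hξf x]
  have hsum := ξ.sum_cycleType
  rw [hsupp, Finset.card_univ, hα, hct, Multiset.sum_replicate, smul_eq_mul] at hsum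
  have hcard : ξ.cycleType.card = n := by omega
  rw [hcard] at hct
  rw [nat_card_centralizer, hct, hα]
  rcases Nat.eq_zero_or_pos n with rfl | hn
  · simp
  · simp [Multiset.toFinset_replicate, hn.ne', mul_comm]

end Equiv.Perm

/-- For every irreducible complex character `χ` of `G = S_{2n}`, the sum `Σ_{h ∈ H} χ(h)`
equals either `0` or `|H| = 2ⁿ·n!` (so `(S_{2n}, H)` is a Gelfand pair). -/
theorem stmt4 (n : ℕ) (hn : 1 ≤ n) (ξ : PermG n)
    (hinv : ξ * ξ = 1) (hfpf : ∀ x, ξ x ≠ x)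
    (V : FDRep ℂ (PermG n)) (hV : CategoryTheory.Simple V) :
    (∑ᶠ h : wreathH n ξ, V.character (h : PermG n)) = 0 ∨
      (∑ᶠ h : wreathH n ξ, V.character (h : PermG n)) = ((2 ^ n * n.factorial : ℕ) : ℂ) := by
  classical
  have := V.isIrreducible_of_simple
  have : Invertible (Fintype.card (wreathH n ξ) : ℂ) :=
    invertibleOfNonzero (Nat.cast_ne_zero.2 Fintype.card_ne_zero)
  have hle := Representation.finrank_invariants_subgroup_le_one V.ρ (H := wreathH n ξ)
    (Equiv.Perm.inv_mem_doubleCoset_centralizer ξ hinv hfpf)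
  have hcard : Nat.card (wreathH n ξ) = 2 ^ n * n.factorial :=
    Equiv.Perm.nat_card_centralizer_of_involution (by simp) ξ hinv hfpf
  have hsum : ∑ᶠ h : wreathH n ξ, V.character (h : PermG n) =
      (Nat.card (wreathH n ξ) : ℂ) *
        Module.finrank ℂ (Representation.invariants (V.ρ.comp (wreathH n ξ).subtype)) := by
    rw [← Representation.card_inv_mul_sum_char_eq_finrank, mul_inv_cancel_left₀
      (Nat.cast_ne_zero.2 Nat.card_pos.ne'), finsum_eq_sum_of_fintype]
    rfl
  rw [hsum, hcard]
  interval_cases Module.finrank ℂ (Representation.invariants (V.ρ.comp (wreathH n ξ).subtype))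
  · simp
  · simp
end

section
/- Z₃(2n) equals the sum, over all triples (χ₁, χ₂, χ₃) of irreducible complex characters of G = S_{2n} satisfying Σ_{h ∈ H} χᵢ(h) ≠ 0 for each i = 1,2,3, of the Kronecker coefficient C(χ₁,χ₂,χ₃) = (1/(2n)!) · Σ_{γ ∈ G} χ₁(γ)·χ₂(γ)·χ₃(γ). -/
/-- The set of irreducible complex characters of `G = S_{2n}`: characters of irreducible
finite-dimensional complex representations. -/
def irredChars (n : ℕ) : Set (PermG n → ℂ) :=
  {χ | ∃ V : FDRep ℂ (PermG n), CategoryTheory.Simple V ∧ χ = V.character}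

/-- The irreducible complex characters `χ` of `G = S_{2n}` with `Σ_{h ∈ H} χ(h) ≠ 0`
(those labelled by partitions of `2n` all of whose row lengths are even). -/
def goodChars (n : ℕ) (ξ : PermG n) : Set (PermG n → ℂ) :=
  {χ ∈ irredChars n | (∑ᶠ h : wreathH n ξ, χ (h : PermG n)) ≠ 0}

section Characters

variable {G : Type} [Group G] {V : Type} [AddCommGroup V] [Module ℂ V]
  (ρ : Representation ℂ G V)

theorem Representation.exists_isCompl_of_not_isIrreducible [Finite G] [Nontrivial V]
    (h : ¬ ρ.IsIrreducible) :
    ∃ p q : Subrepresentation ρ, IsCompl p q ∧ p ≠ ⊥ ∧ q ≠ ⊥ := by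
  by_contra! hpq
  have hnt : (⊥ : Subrepresentation ρ) ≠ ⊤ := fun e =>
    bot_ne_top (α := Submodule ℂ V) (congrArg Subrepresentation.toSubmodule e)
  refine h { exists_pair_ne := ⟨⊥, ⊤, hnt⟩, eq_bot_or_eq_top := fun p => ?_ }
  · obtain ⟨q, hq⟩ := exists_isCompl p
    by_cases hp : p = ⊥
    · exact Or.inl hp
    · have := hpq p q hq hp
      subst this
      exact Or.inr (by simpa using hq.sup_eq_top)

theorem Subrepresentation.nontrivial_of_ne_bot {ρ : Representation ℂ G V}
    {p : Subrepresentation ρ} (h : p ≠ ⊥) : Nontrivial p.toSubmodule := by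
  rw [Submodule.nontrivial_iff_ne_bot]
  exact fun e => h (Subrepresentation.toSubmodule_injective e)

variable [FiniteDimensional ℂ V]

theorem Representation.character_eq_add_of_isCompl {p q : Subrepresentation ρ}
    (h : IsCompl p q) :
    ρ.character = p.toRepresentation.character + q.toRepresentation.character := by
  have hc : IsCompl p.toSubmodule q.toSubmodule := by
    constructor
    · rw [disjoint_iff, ← Subrepresentation.toSubmodule_inf, h.inf_eq_bot]; rfl
    · rw [codisjoint_iff, ← Subrepresentation.toSubmodule_sup, h.sup_eq_top]; rfl
  ext g
  have key : ρ g = (Submodule.prodEquivOfIsCompl _ _ hc).conj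
      ((p.toRepresentation g).prodMap (q.toRepresentation g)) := by
    ext v
    obtain ⟨⟨a, b⟩, rfl⟩ := (Submodule.prodEquivOfIsCompl _ _ hc).surjective v
    simp [LinearEquiv.conj_apply, Subrepresentation.toRepresentation]
  simp only [Representation.character, Pi.add_apply]
  rw [key, LinearMap.trace_conj', LinearMap.trace_prodMap']

/-- A function on `G` is an irreducible character if it is the character of an irreducible
finite-dimensional complex representation. -/
def IsIrredChar (χ : G → ℂ) : Prop :=
  ∃ (V : Type) (_ : AddCommGroup V) (_ : Module ℂ V) (_ : FiniteDimensional ℂ V)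
    (ρ : Representation ℂ G V), ρ.IsIrreducible ∧ χ = ρ.character

theorem Representation.exists_multiset_irredChar [Finite G] :
    ∃ M : Multiset (G → ℂ), (∀ χ ∈ M, IsIrredChar χ) ∧ ρ.character = M.sum := by
  induction hd : Module.finrank ℂ V using Nat.strong_induction_on generalizing V with
  | _ d ih =>
    rcases subsingleton_or_nontrivial V with hV | hV
    · refine ⟨0, by simp, ?_⟩
      ext g
      have : ρ g = 0 := LinearMap.ext fun _ => Subsingleton.elim _ _
      simp [Representation.character, this]
    by_cases hρ : ρ.IsIrreducible
    · exact ⟨{ρ.character}, by simpa using ⟨V, _, _, inferInstance, ρ, hρ, rfl⟩, by simp⟩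
    obtain ⟨p, q, hpq, hp, hq⟩ := ρ.exists_isCompl_of_not_isIrreducible hρ
    have key : ∀ p q : Subrepresentation ρ, IsCompl p q → q ≠ ⊥ →
        Module.finrank ℂ p.toSubmodule < d := by
      intro p q hpq hq
      rw [← hd]
      refine Submodule.finrank_lt fun e => hq ?_
      have : p = ⊤ := Subrepresentation.toSubmodule_injective e
      subst this
      simpa using hpq.inf_eq_bot
    obtain ⟨M, hM, hM'⟩ := ih _ (key p q hpq hq) p.toRepresentation rfl
    obtain ⟨N, hN, hN'⟩ := ih _ (key q p hpq.symm hp) q.toRepresentation rfl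
    refine ⟨M + N, fun χ h => ?_, ?_⟩
    · rcases Multiset.mem_add.1 h with h | h
      exacts [hM _ h, hN _ h]
    · rw [ρ.character_eq_add_of_isCompl hpq, hM', hN', Multiset.sum_add]

variable [Fintype G]

open scoped Classical in
theorem IsIrredChar.sum_mul_inv {χ ψ : G → ℂ} (hχ : IsIrredChar χ) (hψ : IsIrredChar ψ) :
    ∑ g, χ g * ψ g⁻¹ = if χ = ψ then (Nat.card G : ℂ) else 0 := by
  obtain ⟨V, _, _, _, ρ, hρ, rfl⟩ := hχ
  obtain ⟨W, _, _, _, σ, hσ, rfl⟩ := hψ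
  have h0 : (Nat.card G : ℂ) ≠ 0 := Nat.cast_ne_zero.2 Nat.card_pos.ne'
  have := invertibleOfNonzero h0
  have hne : Nonempty (Representation.Equiv σ ρ) ↔ ρ.character = σ.character := by
    refine ⟨fun ⟨e⟩ => (Representation.char_iso e).symm, fun e => ?_⟩
    have h1 := Representation.char_orthonormal ρ σ
    have h2 := Representation.char_orthonormal ρ ρ
    rw [if_pos ⟨.refl _⟩] at h2
    by_contra hn
    rw [if_neg hn, ← e, h2] at h1
    exact one_ne_zero h1
  have h1 := Representation.char_orthonormal ρ σ
  rw [inv_mul_eq_iff_eq_mul₀ h0] at h1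
  rw [h1]
  simp only [hne, mul_ite, mul_one, mul_zero]

open scoped Classical in
theorem sum_multiset_mul_inv {M : Multiset (G → ℂ)} (hM : ∀ χ ∈ M, IsIrredChar χ)
    {ψ : G → ℂ} (hψ : IsIrredChar ψ) :
    ∑ g, M.sum g * ψ g⁻¹ = Nat.card G * M.count ψ := by
  induction M using Multiset.induction_on with
  | empty => simp
  | cons χ M ih =>
    have h1 := (hM χ (by simp)).sum_mul_inv hψ
    have h2 := ih fun χ h => hM χ (Multiset.mem_cons_of_mem h)
    simp only [Multiset.sum_cons, Pi.add_apply, add_mul, Finset.sum_add_distrib, h1, h2,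
      Multiset.count_cons, eq_comm (a := ψ)]
    split_ifs <;> push_cast <;> ring

theorem Representation.isIrreducible_of_norm_one
    (h : ∑ g, ρ.character g * ρ.character g⁻¹ = Nat.card G) : ρ.IsIrreducible := by
  have h0 : (Nat.card G : ℂ) ≠ 0 := Nat.cast_ne_zero.2 Nat.card_pos.ne'
  have := invertibleOfNonzero h0
  have hV : Nontrivial V := by
    by_contra hn
    rw [not_nontrivial_iff_subsingleton] at hn
    have : ∀ g, ρ g = 0 := fun g => LinearMap.ext fun _ => Subsingleton.elim _ _
    apply h0
    rw [← h]
    simp [Representation.character, this]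
  by_contra hρ
  obtain ⟨p, q, hpq, hp, hq⟩ := ρ.exists_isCompl_of_not_isIrreducible hρ
  have hpos : ∀ p : Subrepresentation ρ, p ≠ ⊥ → 1 ≤
      Module.finrank ℂ (Representation.IntertwiningMap p.toRepresentation p.toRepresentation) := by
    intro p hp
    have := Subrepresentation.nontrivial_of_ne_bot hp
    obtain ⟨v, hv⟩ := exists_ne (0 : p.toSubmodule)
    have : FiniteDimensional ℂ
        (Representation.IntertwiningMap p.toRepresentation p.toRepresentation) :=
      Module.Finite.equiv
        (p.toRepresentation.invariantsEquivIntertwiningMap p.toRepresentation)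
    have : Nontrivial (Representation.IntertwiningMap p.toRepresentation p.toRepresentation) :=
      ⟨1, 0, fun e => hv (by simpa using congrArg (fun f => f v) e)⟩
    exact Module.finrank_pos
  have e1 := Representation.card_inv_mul_sum_char_mul_char_eq_finrank
    p.toRepresentation p.toRepresentation
  have e2 := Representation.card_inv_mul_sum_char_mul_char_eq_finrank
    p.toRepresentation q.toRepresentation
  have e3 := Representation.card_inv_mul_sum_char_mul_char_eq_finrank
    q.toRepresentation p.toRepresentation
  have e4 := Representation.card_inv_mul_sum_char_mul_char_eq_finrank
    q.toRepresentation q.toRepresentation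
  have e : (Nat.card G : ℂ)⁻¹ * ∑ g, ρ.character g * ρ.character g⁻¹ = 1 := by
    rw [h, inv_mul_cancel₀ h0]
  simp only [ρ.character_eq_add_of_isCompl hpq, Pi.add_apply, add_mul, mul_add,
    Finset.sum_add_distrib] at e
  rw [e1, e2, e3, e4] at e
  norm_cast at e
  have := hpos p hp
  have := hpos q hq
  omega

end Characters

theorem mem_irredChars_iff {n : ℕ} {χ : PermG n → ℂ} : χ ∈ irredChars n ↔ IsIrredChar χ := by
  constructor
  · rintro ⟨V, hV, rfl⟩
    exact ⟨V, _, _, inferInstance, V.ρ, Representation.isIrreducible_of_norm_one _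
      ((FDRep.simple_iff_char_is_norm_one V).1 hV), rfl⟩
  · classical
    intro h
    have h1 := h.sum_mul_inv h
    rw [if_pos rfl] at h1
    obtain ⟨V, _, _, _, ρ, hρ, rfl⟩ := h
    exact ⟨FDRep.of ρ, (FDRep.simple_iff_char_is_norm_one _).2 h1, rfl⟩

section Gelfand

variable {G : Type} [Group G] (H : Subgroup G)

/-- A finite-dimensional irreducible complex representation has an at most one-dimensional space
of `H`-invariants when every double coset of `H` is closed under inversion. -/
theorem Representation.finrank_invariants_le_one [Finite G]
    (hH : ∀ g : G, ∃ a ∈ H, ∃ b ∈ H, g⁻¹ = a * g * b)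
    {V : Type} [AddCommGroup V] [Module ℂ V] [FiniteDimensional ℂ V]
    (ρ : Representation ℂ G V) (hρ : ρ.IsIrreducible) :
    Module.finrank ℂ (Representation.invariants (ρ.comp H.subtype)) ≤ 1 := by
  classical
  have := Fintype.ofFinite H
  set W := Representation.invariants (ρ.comp H.subtype)
  set E : Module.End ℂ V := ∑ h : H, ρ h with hE
  have hEl : ∀ a ∈ H, ρ a * E = E := by
    intro a ha
    rw [hE, Finset.mul_sum]
    simp_rw [← map_mul]
    exact Equiv.sum_comp (Equiv.mulLeft (⟨a, ha⟩ : H)) fun h : H => ρ (h : G)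
  have hEr : ∀ a ∈ H, E * ρ a = E := by
    intro a ha
    rw [hE, Finset.sum_mul]
    simp_rw [← map_mul]
    exact Equiv.sum_comp (Equiv.mulRight (⟨a, ha⟩ : H)) fun h : H => ρ (h : G)
  have hinv : ∀ g, E * ρ g⁻¹ * E = E * ρ g * E := by
    intro g
    obtain ⟨a, ha, b, hb, e⟩ := hH g
    rw [e, map_mul, map_mul]
    calc E * (ρ a * ρ g * ρ b) * E = (E * ρ a) * ρ g * (ρ b * E) := by simp only [mul_assoc]
      _ = _ := by rw [hEr a ha, hEl b hb]
  have hEE : E * E = (Fintype.card H : ℂ) • E := by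
    conv_lhs => enter [1]; rw [hE]
    rw [Finset.sum_mul, Finset.sum_congr rfl fun (h : H) _ => hEl h h.2]
    simp [← Nat.cast_smul_eq_nsmul ℂ]
  have hc : (Fintype.card H : ℂ) ≠ 0 := Nat.cast_ne_zero.2 Fintype.card_ne_zero
  have hT : ∀ g g', (E * ρ g * E) * (E * ρ g' * E) =
      (Fintype.card H : ℂ) • ∑ h : H, E * ρ (g * h * g') * E := by
    intro g g'
    calc (E * ρ g * E) * (E * ρ g' * E) = E * ρ g * (E * E) * ρ g' * E := by
          simp only [mul_assoc]
      _ = (Fintype.card H : ℂ) • (E * ρ g * E * ρ g' * E) := by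
          rw [hEE]; simp only [mul_smul_comm, smul_mul_assoc]
      _ = _ := by
          congr 1
          rw [show E * ρ g * E * ρ g' * E = E * ρ g * (∑ h : H, ρ h) * ρ g' * E from rfl]
          simp only [Finset.mul_sum, Finset.sum_mul, map_mul, mul_assoc]
  have hcomm : ∀ g g', (E * ρ g * E) * (E * ρ g' * E) = (E * ρ g' * E) * (E * ρ g * E) := by
    intro g g'
    rw [hT, ← hinv g, ← hinv g', hT,
      ← Equiv.sum_comp (Equiv.inv H) fun h : H => E * ρ (g'⁻¹ * h * g⁻¹) * E]
    congr 1
    refine Finset.sum_congr rfl fun h _ => ?_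
    rw [← hinv (g * h * g')]
    simp only [mul_inv_rev, Equiv.inv_apply, InvMemClass.coe_inv, mul_assoc]
  have hEW : ∀ w ∈ W, E w = (Fintype.card H : ℂ) • w := by
    intro w hw
    rw [hE, LinearMap.sum_apply, Finset.sum_congr rfl fun (h : H) _ => show ρ h w = w from hw h]
    simp [← Nat.cast_smul_eq_nsmul ℂ]
  have hWE : ∀ v, E v ∈ W := fun v h => by
    exact congrArg (fun f : Module.End ℂ V => f v) (hEl h h.2)
  have hcyc : ∀ w ∈ W, w ≠ 0 → ∀ v ∈ W,
      v ∈ Submodule.span ℂ (Set.range fun g => (E * ρ g * E) w) := by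
    intro w hw hw0 v hv
    let p : Subrepresentation ρ :=
      { toSubmodule := Submodule.span ℂ (Set.range fun g => ρ g w)
        apply_mem_toSubmodule := fun g v hv => by
          induction hv using Submodule.span_induction with
          | mem x hx =>
            obtain ⟨g', rfl⟩ := hx
            exact Submodule.subset_span ⟨g * g', by simp⟩
          | zero => simp
          | add x y _ _ hx hy => rw [map_add]; exact add_mem hx hy
          | smul c x _ hx => rw [map_smul]; exact Submodule.smul_mem _ _ hx }
    have hp : p = ⊤ := by
      refine (hρ.eq_bot_or_eq_top p).resolve_left fun h => hw0 ?_
      have : w ∈ p.toSubmodule := Submodule.subset_span ⟨1, by simp⟩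
      rw [h] at this
      exact (Submodule.mem_bot ℂ).1 this
    have hv' : v ∈ Submodule.span ℂ (Set.range fun g => ρ g w) := by
      change v ∈ p.toSubmodule
      rw [hp]
      exact Submodule.mem_top
    have hgen : ∀ x ∈ Submodule.span ℂ (Set.range fun g => ρ g w),
        E x ∈ Submodule.span ℂ (Set.range fun g => (E * ρ g * E) w) := by
      intro x hx
      induction hx using Submodule.span_induction with
      | mem x hx =>
        obtain ⟨g, rfl⟩ := hx
        have h1 : (E * ρ g * E) w = (Fintype.card H : ℂ) • E (ρ g w) := by
          simp [Module.End.mul_apply, hEW w hw]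
        have h2 : E (ρ g w) = (Fintype.card H : ℂ)⁻¹ • (E * ρ g * E) w := by
          rw [h1, smul_smul, inv_mul_cancel₀ hc, one_smul]
        change E (ρ g w) ∈ _
        rw [h2]
        exact Submodule.smul_mem _ _ (Submodule.subset_span ⟨g, rfl⟩)
      | zero => simp
      | add x y _ _ hx hy => rw [map_add]; exact add_mem hx hy
      | smul c x _ hx => rw [map_smul]; exact Submodule.smul_mem _ _ hx
    have h3 := hgen v hv'
    rw [hEW v hv] at h3
    exact (Submodule.smul_mem_iff _ hc).1 h3
  rcases subsingleton_or_nontrivial W with hs | hs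
  · simp [Module.finrank_zero_of_subsingleton]
  have hscalar : ∀ g, ∃ c : ℂ, ∀ w ∈ W, (E * ρ g * E) w = c • w := by
    intro g
    let T : Module.End ℂ W := (E * ρ g * E).restrict fun v _ => by
      rw [mul_assoc]; exact hWE _
    obtain ⟨c, hc⟩ := Module.End.exists_eigenvalue T
    obtain ⟨⟨w, hw⟩, hw'⟩ := hc.exists_hasEigenvector
    have hTw : (E * ρ g * E) w = c • w := congrArg Subtype.val hw'.apply_eq_smul
    refine ⟨c, fun v hv => ?_⟩
    have hmem := hcyc w hw (fun e => hw'.2 (Subtype.ext e)) v hv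
    have hle : Submodule.span ℂ (Set.range fun g => (E * ρ g * E) w) ≤
        LinearMap.ker (E * ρ g * E - c • (1 : Module.End ℂ V)) := by
      rw [Submodule.span_le]
      rintro _ ⟨g', rfl⟩
      have := congrArg (fun f : Module.End ℂ V => f w) (hcomm g g')
      simp only [Module.End.mul_apply (E * ρ g * E), Module.End.mul_apply (E * ρ g' * E)] at this
      simp only [SetLike.mem_coe, LinearMap.mem_ker, LinearMap.sub_apply, LinearMap.smul_apply,
        Module.End.one_apply]
      rw [this, hTw, map_smul, sub_self]
    simpa [sub_eq_zero] using hle hmem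
  obtain ⟨⟨w, hw⟩, hw0⟩ := exists_ne (0 : W)
  refine finrank_le_one (⟨w, hw⟩ : W) fun v => ?_
  have hmem := hcyc w hw (fun e => hw0 (Subtype.ext e)) v v.2
  have hle : Submodule.span ℂ (Set.range fun g => (E * ρ g * E) w) ≤ Submodule.span ℂ {w} := by
    rw [Submodule.span_le]
    rintro _ ⟨g, rfl⟩
    obtain ⟨c, hc⟩ := hscalar g
    exact Submodule.mem_span_singleton.2 ⟨c, (hc w hw).symm⟩
  obtain ⟨c, hc⟩ := Submodule.mem_span_singleton.1 (hle hmem)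
  exact ⟨c, Subtype.ext hc⟩

end Gelfand

section Permutation

variable {G : Type} [Group G] {X : Type} [MulAction G X]

variable (G X) in
/-- The permutation representation of `G` on complex functions on `X`. -/
def permRep : Representation ℂ G (X → ℂ) where
  toFun g := LinearMap.funLeft ℂ ℂ fun x => g⁻¹ • x
  map_one' := by ext; simp [LinearMap.funLeft]
  map_mul' g h := by ext; simp [LinearMap.funLeft, mul_smul]

theorem permRep_character [Fintype X] (g : G) :
    (permRep G X).character g = (Nat.card (MulAction.fixedBy X g) : ℂ) := by
  classical
  rw [Representation.character, LinearMap.trace_eq_matrix_trace ℂ (Pi.basisFun ℂ X), Matrix.trace]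
  have : ∀ x : X, LinearMap.toMatrix (Pi.basisFun ℂ X) (Pi.basisFun ℂ X) (permRep G X g) x x =
      if g • x = x then 1 else 0 := by
    intro x
    rw [LinearMap.toMatrix_apply]
    simp [permRep, LinearMap.funLeft_apply, Pi.single_apply, inv_smul_eq_iff, eq_comm (a := x)]
  simp only [Matrix.diag_apply, this, Finset.sum_boole]
  rw [Nat.card_eq_fintype_card, Fintype.card_subtype]
  rfl

open scoped Classical in
theorem sum_permRep_quotient_character [Fintype G] (H : Subgroup G) {ψ : G → ℂ}
    (hψ : ∀ g x, ψ (x * g * x⁻¹) = ψ g) :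
    ∑ g, (permRep G (G ⧸ H)).character g * ψ g⁻¹ = Nat.card (G ⧸ H) * ∑ h : H, ψ h := by
  have h1 : ∀ g, (permRep G (G ⧸ H)).character g = ∑ q : G ⧸ H, if g • q = q then 1 else 0 := by
    intro g
    rw [permRep_character, Finset.sum_boole, Nat.card_eq_fintype_card, Fintype.card_subtype]
    rfl
  have h2 : ∀ q : G ⧸ H, ∑ g : G, (if g • q = q then 1 else 0) * ψ g⁻¹ = ∑ h : H, ψ h := by
    intro q
    induction q using QuotientGroup.induction_on with
    | H x =>
      rw [← Equiv.sum_comp (MulAut.conj x).toEquiv, ← Equiv.sum_comp (Equiv.inv G)]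
      have h3 : ∀ g : G, (x * g⁻¹ * x⁻¹) • (x : G ⧸ H) = x ↔ g ∈ H := by
        intro g
        rw [MulAction.Quotient.smul_coe, QuotientGroup.eq]
        simp [mul_assoc]
      have h4 : ∀ g : G, ψ (x * g⁻¹ * x⁻¹)⁻¹ = ψ g := by
        intro g
        rw [← hψ g x]
        simp [mul_assoc]
      simp only [MulEquiv.toEquiv_eq_coe, Equiv.inv_apply, EquivLike.coe_coe,
        MulAut.conj_apply, h3, h4, ite_mul, one_mul, zero_mul]
      rw [← Finset.sum_filter]
      exact Finset.sum_subtype _ (by simp) ψ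
  simp only [h1, Finset.sum_mul]
  rw [Finset.sum_comm, Finset.sum_congr rfl fun q _ => h2 q]
  simp

open scoped Classical in
theorem permRep_quotient_character_eq_sum [Fintype G] (H : Subgroup G)
    (hH : ∀ g : G, ∃ a ∈ H, ∃ b ∈ H, g⁻¹ = a * g * b) :
    ∃ S : Finset (G → ℂ), (∀ χ, χ ∈ S ↔ IsIrredChar χ ∧ ∑ h : H, χ h ≠ 0) ∧
      (permRep G (G ⧸ H)).character = ∑ χ ∈ S, χ := by
  obtain ⟨M, hM, hπ⟩ := (permRep G (G ⧸ H)).exists_multiset_irredChar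
  have hcard : (Nat.card G : ℂ) = Nat.card (G ⧸ H) * Nat.card H := by
    exact_mod_cast H.card_eq_card_quotient_mul_card_subgroup
  have hG : (Nat.card G : ℂ) ≠ 0 := Nat.cast_ne_zero.2 Nat.card_pos.ne'
  have hH0 : (Nat.card H : ℂ) ≠ 0 := Nat.cast_ne_zero.2 Nat.card_pos.ne'
  have hQ0 : (Nat.card (G ⧸ H) : ℂ) ≠ 0 := Nat.cast_ne_zero.2 Nat.card_pos.ne'
  have key : ∀ ψ, IsIrredChar ψ →
      M.count ψ ≤ 1 ∧ ∑ h : H, ψ h = Nat.card H * (M.count ψ : ℂ) := by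
    intro ψ hψ
    have e := sum_multiset_mul_inv hM hψ
    obtain ⟨V, _, _, _, ρ, hρ, rfl⟩ := hψ
    rw [← hπ, sum_permRep_quotient_character H fun g x => ρ.char_conj g x, hcard, mul_assoc] at e
    have e' := mul_left_cancel₀ hQ0 e
    refine ⟨?_, e'⟩
    have := invertibleOfNonzero hH0
    have hf := Representation.card_inv_mul_sum_char_eq_finrank
      (ρ.comp H.subtype : Representation ℂ H V)
    change (Nat.card H : ℂ)⁻¹ * ∑ h : H, ρ.character h = _ at hf
    rw [e', inv_mul_cancel_left₀ hH0] at hf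
    rw [Nat.cast_inj.1 hf]
    exact ρ.finrank_invariants_le_one H hH hρ
  have hnd : M.Nodup := Multiset.nodup_iff_count_le_one.2 fun ψ => by
    by_cases h : ψ ∈ M
    · exact (key ψ (hM ψ h)).1
    · simp [Multiset.count_eq_zero_of_notMem h]
  refine ⟨⟨M, hnd⟩, fun χ => ?_, ?_⟩
  · rw [Finset.mem_mk]
    constructor
    · intro h
      refine ⟨hM χ h, ?_⟩
      rw [(key χ (hM χ h)).2]
      exact mul_ne_zero hH0 (Nat.cast_ne_zero.2 (Multiset.count_ne_zero.2 h))
    · rintro ⟨h, hne⟩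
      rw [(key χ h).2] at hne
      exact Multiset.count_ne_zero.1 fun h0 => hne (by simp [h0])
  · rw [hπ]
    exact congrArg Multiset.sum (Multiset.map_id' M).symm

end Permutation

section Involutions

/-- Two fixed-point-free involutions of a type are exchanged by conjugation with an involution. -/
theorem exists_conj_swap_of_involutive {α : Type*} {a b : Equiv.Perm α}
    (ha : a * a = 1) (hb : b * b = 1) (ha' : ∀ x, a x ≠ x) (hb' : ∀ x, b x ≠ x) :
    ∃ x : Equiv.Perm α, x * a = b * x ∧ x * b = a * x := by
  set r := a * b with hr
  have haa : ∀ x, a (a x) = x := fun x => DFunLike.congr_fun ha x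
  have hbb : ∀ x, b (b x) = x := fun x => DFunLike.congr_fun hb x
  have hai : a⁻¹ = a := inv_eq_of_mul_eq_one_left ha
  have hbi : b⁻¹ = b := inv_eq_of_mul_eq_one_left hb
  have hra : ∀ k : ℤ, a * r ^ k = r ^ (-k) * a := by
    intro k
    have h1 : a * r * a⁻¹ = r⁻¹ := by
      rw [hr, mul_inv_rev, hai, hbi, ← mul_assoc, ha, one_mul]
    have h2 : (a * r * a⁻¹) ^ k = a * r ^ k * a⁻¹ := conj_zpow
    rw [h1, inv_zpow'] at h2
    rw [h2, inv_mul_cancel_right]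
  have har : a * r = b := by rw [hr, ← mul_assoc, ha, one_mul]
  have hfix : ∀ (k : ℤ) x, a ((r ^ k) x) ≠ x := by
    intro k x h
    obtain ⟨j, rfl | rfl⟩ := Int.even_or_odd' k
    · apply ha' ((r ^ j) x)
      have : a * r ^ j = r ^ j * (a * r ^ (2 * j)) := by
        rw [hra, hra, ← mul_assoc, ← zpow_add]; congr 2; ring
      calc a ((r ^ j) x) = (a * r ^ j) x := rfl
        _ = (r ^ j) (a ((r ^ (2 * j)) x)) := by rw [this]; rfl
        _ = _ := by rw [h]
    · apply hb' ((r ^ j) x)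
      have : b * r ^ j = r ^ j * (a * r ^ (2 * j + 1)) := by
        rw [← har, mul_assoc, ← zpow_one_add, hra, hra, ← mul_assoc, ← zpow_add]; congr 2; ring
      calc b ((r ^ j) x) = (b * r ^ j) x := rfl
        _ = (r ^ j) (a ((r ^ (2 * j + 1)) x)) := by rw [this]; rfl
        _ = _ := by rw [h]
  let s : Setoid α := MulAction.orbitRel (Subgroup.closure {a, b}) α
  let base : α → α := fun y => (Quotient.mk s y).out
  have hbase_smul : ∀ c ∈ Subgroup.closure {a, b}, ∀ y, base (c y) = base y := by
    intro c hc y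
    have : Quotient.mk s (c y) = Quotient.mk s y :=
      Quotient.sound (MulAction.orbitRel_apply.2 ⟨⟨c, hc⟩, rfl⟩)
    simp only [base, this]
  have hbase_a : ∀ y, base (a y) = base y := hbase_smul a (Subgroup.subset_closure (by simp))
  have hbase_b : ∀ y, base (b y) = base y := hbase_smul b (Subgroup.subset_closure (by simp))
  let R : α → α → Prop := fun y z => ∃ k : ℤ,
    (y = (r ^ k) (base y) ∧ z = (r ^ (-k)) (base y)) ∨
    (y = a ((r ^ k) (base y)) ∧ z = b ((r ^ (-k)) (base y)))
  have hbaz : ∀ (k : ℤ) x, b (a ((r ^ k) x)) = (r ^ (k - 1)) x := by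
    intro k x
    have : b * (a * r ^ k) = r ^ (k - 1) := by
      rw [← mul_assoc, show b * a = r⁻¹ by rw [hr, mul_inv_rev, hai, hbi], ← zpow_neg_one,
        ← zpow_add]; congr 1; ring
    exact DFunLike.congr_fun this x
  have hbz : ∀ (k : ℤ) x, b ((r ^ k) x) = a ((r ^ (k + 1)) x) := by
    intro k x
    rw [← har, zpow_add_one, (Commute.refl r).zpow_left k |>.eq]; rfl
  have hab : ∀ (k : ℤ) x, a (b ((r ^ k) x)) = (r ^ (k + 1)) x := by
    intro k x
    rw [hbz, haa]
  have haz : ∀ (k : ℤ) x, a ((r ^ k) x) = b ((r ^ (k - 1)) x) := by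
    intro k x
    rw [hbz, sub_add_cancel]
  have hRa : ∀ y z, R y z → R (a y) (b z) := by
    rintro y z ⟨k, ⟨hy, hz⟩ | ⟨hy, hz⟩⟩
    · exact ⟨k, Or.inr ⟨by rw [hbase_a, ← hy], by rw [hbase_a, ← hz]⟩⟩
    · exact ⟨k, Or.inl ⟨by rw [hbase_a]; nth_rw 1 [hy]; rw [haa], by rw [hbase_a, hz, hbb]⟩⟩
  have hRb : ∀ y z, R y z → R (b y) (a z) := by
    rintro y z ⟨k, ⟨hy, hz⟩ | ⟨hy, hz⟩⟩
    · refine ⟨k + 1, Or.inr ⟨?_, ?_⟩⟩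
      · rw [hbase_b, ← hbz, ← hy]
      · rw [hbase_b, hz, haz]; congr 3; ring
    · refine ⟨k - 1, Or.inl ⟨?_, ?_⟩⟩
      · rw [hbase_b, ← hbaz, ← hy]
      · rw [hbase_b, hz, hab]; congr 2; ring
  have huniq : ∀ y z z', R y z → R y z' → z = z' := by
    have hcan : ∀ (k l : ℤ) x, (r ^ k) x = (r ^ l) x → (r ^ (-k)) x = (r ^ (-l)) x := by
      intro k l x h
      have := congrArg (r ^ (-k - l)) h
      simp only [← Equiv.Perm.mul_apply, ← zpow_add] at this
      rw [show -k - l + k = -l by ring, show -k - l + l = -k by ring] at this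
      exact this.symm
    have hmix : ∀ (k l : ℤ) x, (r ^ k) x ≠ a ((r ^ l) x) := by
      intro k l x h
      apply hfix (k + l) x
      have : a * r ^ (k + l) = r ^ (-k) * (a * r ^ l) := by
        rw [hra, hra, ← mul_assoc, ← zpow_add]; congr 2; ring
      calc a ((r ^ (k + l)) x) = (r ^ (-k)) (a ((r ^ l) x)) := DFunLike.congr_fun this x
        _ = x := by rw [← h, zpow_neg]; simp
    rintro y z z' ⟨k, ⟨hy, hz⟩ | ⟨hy, hz⟩⟩ ⟨l, ⟨hy', hz'⟩ | ⟨hy', hz'⟩⟩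
    · rw [hz, hz', hcan k l _ (hy.symm.trans hy')]
    · exact absurd (hy.symm.trans hy') (hmix k l _)
    · exact absurd (hy'.symm.trans hy) (hmix l k _)
    · rw [hz, hz', hcan k l _ (a.injective (hy.symm.trans hy'))]
  have hex : ∀ y, ∃ z, R y z := by
    have hstep : ∀ c ∈ Subgroup.closure {a, b}, ∀ y, (∃ z, R y z) ↔ ∃ z, R (c y) z := by
      intro c hc
      induction hc using Subgroup.closure_induction with
      | mem c hc =>
        rcases hc with rfl | rfl
        · exact fun y => ⟨fun ⟨z, hz⟩ => ⟨_, hRa y z hz⟩,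
            fun ⟨z, hz⟩ => ⟨_, haa y ▸ hRa _ z hz⟩⟩
        · exact fun y => ⟨fun ⟨z, hz⟩ => ⟨_, hRb y z hz⟩,
            fun ⟨z, hz⟩ => ⟨_, hbb y ▸ hRb _ z hz⟩⟩
      | one => exact fun y => Iff.rfl
      | mul c d _ _ hc hd => exact fun y => (hd y).trans (hc (d y))
      | inv c _ hc => exact fun y => by simpa using (hc (c⁻¹ y)).symm
    intro y
    have hbb' : base (base y) = base y := by simp [base]
    have hmem : s (y) (base y) := Setoid.symm' s (Quotient.mk_out (s := s) y)
    obtain ⟨⟨c, hc⟩, hcy⟩ := MulAction.orbitRel_apply.1 hmem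
    have := (hstep c hc (base y)).1 ⟨base y, 0, Or.inl (by simp [hbb'])⟩
    rwa [show c (base y) = y from hcy] at this
  have hsymm : ∀ y z, R y z → R z y := by
    have hb2 : ∀ y, base (base y) = base y := by simp [base]
    have hrc : r ∈ Subgroup.closure {a, b} :=
      mul_mem (Subgroup.subset_closure (by simp)) (Subgroup.subset_closure (by simp))
    have hbr : ∀ (k : ℤ) y, base ((r ^ k) y) = base y := fun k =>
      hbase_smul _ (zpow_mem hrc k)
    rintro y z ⟨k, ⟨hy, hz⟩ | ⟨hy, hz⟩⟩
    · have hbz' : base z = base y := by rw [hz, hbr, hb2]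
      exact ⟨-k, Or.inl ⟨by rw [hbz', hz], by rw [hbz', neg_neg, ← hy]⟩⟩
    · have hbz' : base z = base y := by rw [hz, hbase_b, hbr, hb2]
      refine ⟨1 - k, Or.inr ⟨?_, ?_⟩⟩
      · rw [hbz', hz, hbz]; congr 3; ring
      · rw [hbz', hbz]; nth_rw 1 [hy]; congr 3; ring
  choose f hf using hex
  have hff : Function.Involutive f := fun y => huniq _ _ _ (hf (f y)) (hsymm _ _ (hf y))
  refine ⟨hff.toPerm, ?_, ?_⟩
  · ext y; exact huniq _ _ _ (hf (a y)) (hRa _ _ (hf y))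
  · ext y; exact huniq _ _ _ (hf (b y)) (hRb _ _ (hf y))

theorem wreathH_inv_mem_doubleCoset {n : ℕ} {ξ : PermG n} (hinv : ξ * ξ = 1)
    (hfpf : ∀ x, ξ x ≠ x) (g : PermG n) :
    ∃ a ∈ wreathH n ξ, ∃ b ∈ wreathH n ξ, g⁻¹ = a * g * b := by
  obtain ⟨x, hx, hx'⟩ := exists_conj_swap_of_involutive (a := ξ) (b := g * ξ * g⁻¹) hinv
    (by simp [mul_assoc, ← mul_assoc ξ ξ, hinv]) hfpf
    (fun y h => hfpf (g⁻¹ y) (by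
      rw [Equiv.Perm.eq_inv_iff_eq]; exact h))
  have e1 : ξ * (g⁻¹ * x) = g⁻¹ * x * ξ := by
    rw [mul_assoc g⁻¹, hx]; group
  have e2 : ξ * (x * g) = x * g * ξ := by
    rw [← mul_assoc, ← hx']; group
  refine ⟨g⁻¹ * x, ?_, (x * g)⁻¹, inv_mem ?_, by group⟩
  · exact Subgroup.mem_centralizer_singleton_iff.2 (by first | exact e1 | exact e1.symm)
  · exact Subgroup.mem_centralizer_singleton_iff.2 (by first | exact e2 | exact e2.symm)

end Involutions

section Counting

theorem card_fixedBy_pi {G X ι : Type*} [Group G] [MulAction G X] [Fintype ι] (g : G) :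
    Nat.card (MulAction.fixedBy (ι → X) g) = Nat.card (MulAction.fixedBy X g) ^ Fintype.card ι := by
  have e : MulAction.fixedBy (ι → X) g ≃ (ι → MulAction.fixedBy X g) :=
    (Equiv.subtypeEquivRight fun f => by
      simp [MulAction.mem_fixedBy, funext_iff]).trans
      (Equiv.subtypePiEquivPi (p := fun _ x => g • x = x))
  rw [Nat.card_congr e, Nat.card_pi]
  simp

theorem Znum_eq_card_orbits (n d : ℕ) (ξ : PermG n) :
    Znum n d ξ = Nat.card
      (MulAction.orbitRel.Quotient (PermG n) (Fin d → PermG n ⧸ wreathH n ξ)) := by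
  let F : (Fin d → PermG n) →
      MulAction.orbitRel.Quotient (PermG n) (Fin d → PermG n ⧸ wreathH n ξ) :=
    fun σ => Quotient.mk _ fun i => ((σ i)⁻¹ : PermG n)
  have hF : ∀ σ σ', tensorRel n d ξ σ σ' ↔ F σ = F σ' := by
    intro σ σ'
    rw [Quotient.eq, MulAction.orbitRel_apply, MulAction.mem_orbit_iff]
    constructor
    · rintro ⟨c, g, h⟩
      refine ⟨g, funext fun i => ?_⟩
      rw [Pi.smul_apply, MulAction.Quotient.smul_coe, QuotientGroup.eq, h i]
      simp [mul_assoc]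
    · rintro ⟨g, h⟩
      have h' : ∀ i, σ' i * g⁻¹ * (σ i)⁻¹ ∈ wreathH n ξ := by
        intro i
        have := congrFun h i
        rw [Pi.smul_apply, MulAction.Quotient.smul_coe, QuotientGroup.eq] at this
        simpa [mul_assoc] using this
      exact ⟨fun i => ⟨_, h' i⟩, g, fun i => by simp⟩
  refine Nat.card_congr (Equiv.ofBijective (Quot.lift F fun σ σ' h => (hF σ σ').1 h) ⟨?_, ?_⟩)
  · rintro ⟨σ⟩ ⟨σ'⟩ h
    exact Quot.sound ((hF σ σ').2 h)
  · rintro ⟨q⟩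
    refine ⟨Quot.mk _ fun i => (q i).out⁻¹, ?_⟩
    exact congrArg (Quotient.mk _) (funext fun i => by simp)

theorem Znum_mul_card (n d : ℕ) (ξ : PermG n) :
    Znum n d ξ * (2 * n).factorial =
      ∑ g : PermG n, Nat.card (MulAction.fixedBy (PermG n ⧸ wreathH n ξ) g) ^ d := by
  classical
  have := Fintype.ofFinite
    (MulAction.orbitRel.Quotient (PermG n) (Fin d → PermG n ⧸ wreathH n ξ))
  have := MulAction.sum_card_fixedBy_eq_card_orbits_mul_card_group (PermG n)
    (Fin d → PermG n ⧸ wreathH n ξ)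
  simp only [← Nat.card_eq_fintype_card, card_fixedBy_pi] at this
  rw [Znum_eq_card_orbits]
  simpa [Nat.card_eq_fintype_card, Fintype.card_perm] using this.symm

end Counting

/-- `Z₃(2n)` equals the sum, over all triples `(χ₁, χ₂, χ₃)` of irreducible complex
characters of `G = S_{2n}` satisfying `Σ_{h ∈ H} χᵢ(h) ≠ 0` for each `i`, of the Kronecker
coefficient `C(χ₁,χ₂,χ₃) = (1/(2n)!) · Σ_{γ ∈ G} χ₁(γ)·χ₂(γ)·χ₃(γ)`. -/
theorem stmt5 (n : ℕ) (hn : 1 ≤ n) (ξ : PermG n)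
    (hinv : ξ * ξ = 1) (hfpf : ∀ x, ξ x ≠ x) :
    (Znum n 3 ξ : ℂ) =
      ∑ᶠ χ₁ ∈ goodChars n ξ, ∑ᶠ χ₂ ∈ goodChars n ξ, ∑ᶠ χ₃ ∈ goodChars n ξ,
        (1 / ((2 * n).factorial : ℂ)) * ∑ γ : PermG n, χ₁ γ * χ₂ γ * χ₃ γ := by
  classical
  obtain ⟨S, hS, hπ⟩ := permRep_quotient_character_eq_sum (wreathH n ξ)
    (wreathH_inv_mem_doubleCoset hinv hfpf)
  have hgood : goodChars n ξ = S := by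
    ext χ
    rw [Finset.mem_coe, hS, goodChars, Set.mem_ofPred_eq, mem_irredChars_iff,
      finsum_eq_sum_of_fintype]
  have hfac : ((2 * n).factorial : ℂ) ≠ 0 := Nat.cast_ne_zero.2 (Nat.factorial_ne_zero _)
  have hZ : (Znum n 3 ξ : ℂ) * (2 * n).factorial = ∑ γ : PermG n, (∑ χ ∈ S, χ γ) ^ 3 := by
    have h1 : ∀ γ : PermG n, (∑ χ ∈ S, χ γ) =
        (Nat.card (MulAction.fixedBy (PermG n ⧸ wreathH n ξ) γ) : ℂ) := by
      intro γ
      rw [← permRep_character, hπ, Finset.sum_apply]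
    simp only [h1]
    exact_mod_cast Znum_mul_card n 3 ξ
  simp only [hgood, Finset.mem_coe, finsum_mem_finset_eq_sum]
  rw [← eq_div_iff hfac] at hZ
  simp only [← Finset.mul_sum]
  rw [hZ, div_eq_inv_mul, one_div]
  congr 1
  have h2 : ∀ γ : PermG n, (∑ χ ∈ S, χ γ) ^ 3 =
      ∑ χ₁ ∈ S, ∑ χ₂ ∈ S, ∑ χ₃ ∈ S, χ₁ γ * χ₂ γ * χ₃ γ := by
    intro γ
    simp only [← Finset.mul_sum, ← Finset.sum_mul]
    ring
  simp only [h2]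
  rw [Finset.sum_comm]
  refine Finset.sum_congr rfl fun χ₁ _ => ?_
  rw [Finset.sum_comm]
  refine Finset.sum_congr rfl fun χ₂ _ => ?_
  rw [Finset.sum_comm]
end
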